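/- arXiv:1012.0733 — 2 statements merged into one kernel-verified Lean document; each statement's English description precedes it below -/
import Mathlib

section
/- Let n ≥ 1, let a, b₁, …, b_n, c be real numbers, and let Ã, B̃, C̃ be the associated n×n complex matrices. Then for every κ ∈ ℂ, det(Ã + κ B̃ + κ² C̃) = (a − κ (Σ_{j=1}^n b_j) + (κ²/2) c) · (−κ²)^{n−1}. -/
open Matrix

/-- The matrix à associated with the data a : entry a in position (1,1), all other entries 0. -/
noncomputable def matA (n : ℕ) (a : ℝ) : Matrix (Fin n) (Fin n) ℂ :=
  fun i j => if i.val = 0 ∧ j.val = 0 then (a : ℂ) else 0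

/-- The matrix B̃ associated with the data b₁, …, b_n : first row (-b₁, …, -b_n),
all other rows 0. -/
noncomputable def matB (n : ℕ) (b : Fin n → ℝ) : Matrix (Fin n) (Fin n) ℂ :=
  fun i j => if i.val = 0 then -(b j : ℂ) else 0

/-- The matrix C̃ associated with the data c : entry c/2 in position (1,1), and for
j = 2, …, n entry 1 in position (j, j-1) and entry -1 in position (j, j), all other
entries 0. -/
noncomputable def matC (n : ℕ) (c : ℝ) : Matrix (Fin n) (Fin n) ℂ :=
  fun i j =>
    if i.val = 0 then (if j.val = 0 then (c : ℂ) / 2 else 0)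
    else (if j.val + 1 = i.val then 1 else if j = i then -1 else 0)

/-- The lower triangular matrix of ones; multiplying by it on the right replaces each column by the
sum of the columns from it onwards. -/
noncomputable def lowerOnes (n : ℕ) : Matrix (Fin n) (Fin n) ℂ :=
  fun i j => if j ≤ i then 1 else 0

theorem det_lowerOnes (n : ℕ) : (lowerOnes n).det = 1 := by
  rw [det_of_isLowerTriangular]
  · simp [lowerOnes]
  · intro i j hij
    exact if_neg (not_le.mpr hij)

theorem matrix_pencil_apply_succ (m : ℕ) (a : ℝ) (b : Fin (m + 1) → ℝ) (c : ℝ) (κ : ℂ)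
    (i : Fin m) (k : Fin (m + 1)) :
    (matA (m + 1) a + κ • matB (m + 1) b + κ ^ 2 • matC (m + 1) c) i.succ k
      = (if k = i.castSucc then κ ^ 2 else 0) + (if k = i.succ then -κ ^ 2 else 0) := by
  simp only [Matrix.add_apply, Matrix.smul_apply, matA, matB, matC, Fin.ext_iff, Fin.val_succ,
    Fin.val_castSucc, smul_eq_mul, Nat.succ_ne_zero, false_and, if_false]
  split_ifs <;> first | omega | simp

theorem matrix_pencil_mul_lowerOnes_succ (m : ℕ) (a : ℝ) (b : Fin (m + 1) → ℝ) (c : ℝ) (κ : ℂ)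
    (i : Fin m) (j : Fin (m + 1)) :
    ((matA (m + 1) a + κ • matB (m + 1) b + κ ^ 2 • matC (m + 1) c) * lowerOnes (m + 1)) i.succ j
      = if j = i.succ then -κ ^ 2 else 0 := by
  simp only [Matrix.mul_apply, matrix_pencil_apply_succ, add_mul, ite_mul, zero_mul,
    Finset.sum_add_distrib, Finset.sum_ite_eq', Finset.mem_univ, if_true, lowerOnes]
  simp only [Fin.ext_iff, Fin.le_def, Fin.val_succ, Fin.val_castSucc]
  split_ifs <;> first | omega | simp

theorem matrix_pencil_mul_lowerOnes_zero_zero (m : ℕ) (a : ℝ) (b : Fin (m + 1) → ℝ) (c : ℝ)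
    (κ : ℂ) :
    ((matA (m + 1) a + κ • matB (m + 1) b + κ ^ 2 • matC (m + 1) c) * lowerOnes (m + 1)) 0 0
      = (a : ℂ) - κ * (∑ j, (b j : ℂ)) + κ ^ 2 / 2 * (c : ℂ) := by
  simp only [Matrix.mul_apply, lowerOnes, Fin.zero_le, if_true, mul_one, Matrix.add_apply,
    Matrix.smul_apply, matA, matB, matC, Fin.sum_univ_succ]
  simp [← Finset.mul_sum]
  ring

/-- The determinant formula:
det(Ã + κ B̃ + κ² C̃) = (a - κ Σ b_j + κ²/2 c) (-κ²)^(n-1). -/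
theorem det_matrix_pencil (n : ℕ) (hn : 1 ≤ n)
    (a : ℝ) (b : Fin n → ℝ) (c : ℝ) (κ : ℂ) :
    (matA n a + κ • matB n b + κ ^ 2 • matC n c).det
      = ((a : ℂ) - κ * (∑ j, (b j : ℂ)) + κ ^ 2 / 2 * (c : ℂ)) * (-κ ^ 2) ^ (n - 1) := by
  obtain ⟨m, rfl⟩ := Nat.exists_eq_add_of_le' hn
  rw [← mul_one (det _), ← det_lowerOnes (m + 1), ← det_mul, det_of_isUpperTriangular,
    Fin.prod_univ_succ, matrix_pencil_mul_lowerOnes_zero_zero]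
  · simp [matrix_pencil_mul_lowerOnes_succ]
  · intro i j hij
    induction i using Fin.cases with
    | zero => exact absurd hij (Fin.not_lt_zero j)
    | succ i =>
      rw [matrix_pencil_mul_lowerOnes_succ]
      exact if_neg (ne_of_lt hij)
end

section
/- For every a > 0 and every λ > 0, ∫₀^∞ e^{−λ t} · (a / √(2π t³)) · e^{−a²/(2t)} dt = e^{−√(2λ) · a}. -/
open MeasureTheory Real

open Filter Topology in
/-- The Gaussian primitive `x ↦ ∫₀ˣ e^(-y²/2) dy` tends to `√(2π)/2` at `+∞`. -/
lemma tendsto_integral_gaussian_atTop :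
    Tendsto (fun x : ℝ => ∫ y in (0 : ℝ)..x, Real.exp (-(1 / 2) * y ^ 2)) atTop
      (𝓝 (Real.sqrt (2 * Real.pi) / 2)) := by
  have h := intervalIntegral_tendsto_integral_Ioi (0 : ℝ)
    (integrable_exp_neg_mul_sq (b := 1 / 2) (by norm_num)).integrableOn tendsto_id
  rw [integral_gaussian_Ioi, show Real.pi / (1 / 2) = 2 * Real.pi by ring] at h
  exact h

open Filter Topology in
/-- The Gaussian primitive `x ↦ ∫₀ˣ e^(-y²/2) dy` tends to `-√(2π)/2` at `-∞`. -/
lemma tendsto_integral_gaussian_atBot :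
    Tendsto (fun x : ℝ => ∫ y in (0 : ℝ)..x, Real.exp (-(1 / 2) * y ^ 2)) atBot
      (𝓝 (-(Real.sqrt (2 * Real.pi) / 2))) := by
  refine (tendsto_integral_gaussian_atTop.comp tendsto_neg_atBot_atTop).neg.congr fun x => ?_
  have h := intervalIntegral.integral_comp_neg (a := 0) (b := x)
    fun y : ℝ => Real.exp (-(1 / 2) * y ^ 2)
  simp only [neg_sq, neg_zero] at h
  rw [Function.comp_apply, h, intervalIntegral.integral_symm, neg_neg]

lemma hasDerivAt_integral_gaussian (x : ℝ) :
    HasDerivAt (fun x : ℝ => ∫ y in (0 : ℝ)..x, Real.exp (-(1 / 2) * y ^ 2))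
      (Real.exp (-(1 / 2) * x ^ 2)) x := by
  have hc : Continuous fun y : ℝ => Real.exp (-(1 / 2) * y ^ 2) := by fun_prop
  exact intervalIntegral.integral_hasDerivAt_right (hc.intervalIntegrable _ _)
    (hc.stronglyMeasurableAtFilter _ _) hc.continuousAt

open Filter Topology in
lemma tendsto_mul_sqrt_add_div_sqrt_atTop {c : ℝ} (hc : 0 < c) (b : ℝ) :
    Tendsto (fun t : ℝ => c * Real.sqrt t + b / Real.sqrt t) atTop atTop :=
  (Real.tendsto_sqrt_atTop.const_mul_atTop hc).atTop_add
    (tendsto_const_nhds.div_atTop Real.tendsto_sqrt_atTop)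

open Filter Topology in
lemma tendsto_mul_sqrt_sub_div_sqrt_zero (c : ℝ) {a : ℝ} (ha : 0 < a) :
    Tendsto (fun t : ℝ => c * Real.sqrt t - a / Real.sqrt t) (𝓝[>] 0) atBot := by
  have h0 : Tendsto Real.sqrt (𝓝[>] 0) (𝓝 0) := by
    simpa using (Real.continuous_sqrt.tendsto 0).mono_left nhdsWithin_le_nhds
  have h1 : Tendsto Real.sqrt (𝓝[>] 0) (𝓝[>] 0) :=
    tendsto_nhdsWithin_iff.2 ⟨h0, by
      filter_upwards [self_mem_nhdsWithin] with t ht using Real.sqrt_pos.2 ht⟩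
  have h2 := (tendsto_inv_nhdsGT_zero.comp h1).const_mul_atTop ha
  simpa only [sub_eq_add_neg, div_eq_mul_inv, Function.comp_def] using
    (h0.const_mul c).add_atBot (tendsto_neg_atTop_atBot.comp h2)

lemma hasDerivAt_mul_sqrt_sub_div_sqrt (c a : ℝ) {t : ℝ} (ht : 0 < t) :
    HasDerivAt (fun t : ℝ => c * Real.sqrt t - a / Real.sqrt t)
      (c / (2 * Real.sqrt t) + a / (2 * Real.sqrt t ^ 3)) t := by
  have hs : Real.sqrt t ≠ 0 := (Real.sqrt_pos.2 ht).ne'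
  have h := Real.hasDerivAt_sqrt ht.ne'
  refine ((h.const_mul c).sub ((hasDerivAt_const t a).div h hs)).congr_deriv ?_
  field_simp
  ring

/-- The Laplace transform of the density of the first passage time of standard Brownian
motion to level a > 0 :
∫₀^∞ e^(-λ t) (a / √(2 π t³)) e^(-a²/(2t)) dt = e^(-√(2λ) a). -/
theorem laplace_transform_first_passage_density (a l : ℝ) (ha : 0 < a) (hl : 0 < l) :
    ∫ t in Set.Ioi (0 : ℝ),
        Real.exp (-l * t) * (a / Real.sqrt (2 * Real.pi * t ^ 3)) *
          Real.exp (-a ^ 2 / (2 * t))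
      = Real.exp (-(Real.sqrt (2 * l)) * a) := by
  open Filter Topology in
  set c := Real.sqrt (2 * l) with hc
  have hc0 : 0 < c := Real.sqrt_pos.2 (by positivity)
  have hc2 : c ^ 2 = 2 * l := Real.sq_sqrt (by positivity)
  set K := Real.sqrt (2 * Real.pi) with hK
  have hK0 : 0 < K := Real.sqrt_pos.2 (by positivity)
  let E : ℝ → ℝ := fun x => ∫ y in (0 : ℝ)..x, Real.exp (-(1 / 2) * y ^ 2)
  let F : ℝ → ℝ := fun t =>
    (Real.exp (-c * a) * E (c * Real.sqrt t - a / Real.sqrt t) +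
      Real.exp (c * a) * E (-c * Real.sqrt t - a / Real.sqrt t)) / K
  have hF0 : Tendsto F (𝓝[>] 0)
      (𝓝 ((Real.exp (-c * a) * -(K / 2) + Real.exp (c * a) * -(K / 2)) / K)) :=
    (((tendsto_integral_gaussian_atBot.comp
      (tendsto_mul_sqrt_sub_div_sqrt_zero c ha)).const_mul _).add
      ((tendsto_integral_gaussian_atBot.comp
        (tendsto_mul_sqrt_sub_div_sqrt_zero (-c) ha)).const_mul _)).div_const _
  have hFtop : Tendsto F atTop
      (𝓝 ((Real.exp (-c * a) * (K / 2) + Real.exp (c * a) * -(K / 2)) / K)) := by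
    have h1 : Tendsto (fun t : ℝ => c * Real.sqrt t - a / Real.sqrt t) atTop atTop := by
      simpa only [neg_div, ← sub_eq_add_neg] using
        tendsto_mul_sqrt_add_div_sqrt_atTop hc0 (-a)
    have h2 : Tendsto (fun t : ℝ => -c * Real.sqrt t - a / Real.sqrt t) atTop atBot :=
      (tendsto_neg_atTop_atBot.comp (tendsto_mul_sqrt_add_div_sqrt_atTop hc0 a)).congr
        fun t => by simp only [Function.comp_apply]; ring
    exact (((tendsto_integral_gaussian_atTop.comp h1).const_mul _).add
      ((tendsto_integral_gaussian_atBot.comp h2).const_mul _)).div_const _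
  have hderiv : ∀ t ∈ Set.Ioi (0 : ℝ), HasDerivAt F
      (Real.exp (-l * t) * (a / Real.sqrt (2 * Real.pi * t ^ 3)) *
        Real.exp (-a ^ 2 / (2 * t))) t := by
    intro t ht
    have ht : 0 < t := ht
    have hs : 0 < Real.sqrt t := Real.sqrt_pos.2 ht
    have hst : Real.sqrt t ^ 2 = t := Real.sq_sqrt ht.le
    have hsqrt : Real.sqrt (2 * Real.pi * t ^ 3) = K * Real.sqrt t ^ 3 := by
      rw [Real.sqrt_mul (by positivity), ← hK]
      congr 1
      rw [Real.sqrt_eq_iff_mul_self_eq (by positivity) (by positivity)]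
      rw [← pow_two, ← pow_mul, mul_comm, pow_mul, hst]
    have hexp : ∀ d : ℝ, d ^ 2 = 2 * l →
        Real.exp (-d * a) * Real.exp (-(1 / 2) * (d * Real.sqrt t - a / Real.sqrt t) ^ 2) =
          Real.exp (-l * t) * Real.exp (-a ^ 2 / (2 * t)) := by
      intro d hd
      rw [← Real.exp_add, ← Real.exp_add]
      congr 1
      have hsq : (d * Real.sqrt t - a / Real.sqrt t) ^ 2 = 2 * l * t - 2 * d * a + a ^ 2 / t := by
        rw [sub_sq, mul_pow, div_pow, hst, hd]
        field_simp
      rw [hsq]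
      field_simp
      ring
    have e1 := hexp c hc2
    have e2 := hexp (-c) (by rw [neg_sq, hc2])
    rw [neg_neg] at e2
    have d1 := ((hasDerivAt_integral_gaussian _).comp t
      (hasDerivAt_mul_sqrt_sub_div_sqrt c a ht)).const_mul (Real.exp (-c * a))
    have d2 := ((hasDerivAt_integral_gaussian _).comp t
      (hasDerivAt_mul_sqrt_sub_div_sqrt (-c) a ht)).const_mul (Real.exp (c * a))
    refine ((d1.add d2).div_const K).congr_deriv ?_
    rw [← mul_assoc, ← mul_assoc, e1, e2, hsqrt]
    field_simp
    ring
  let G := Function.update F 0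
    ((Real.exp (-c * a) * -(K / 2) + Real.exp (c * a) * -(K / 2)) / K)
  have hGF : ∀ t ∈ Set.Ioi (0 : ℝ), G =ᶠ[𝓝 t] F := fun t ht => by
    filter_upwards [isOpen_ne.mem_nhds (ne_of_gt ht)] with s hs
      using Function.update_of_ne hs _ _
  have hG0 : ContinuousWithinAt G (Set.Ici 0) 0 := by
    rw [continuousWithinAt_update_same, Set.Ici_sdiff_left]
    exact hF0
  have hGtop := hFtop.congr' (f₂ := G) <| by
    filter_upwards [eventually_gt_atTop 0] with t ht using (hGF t ht).eq_of_nhds.symm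
  rw [integral_Ioi_of_hasDerivAt_of_nonneg hG0
    (fun t ht => (hderiv t ht).congr_of_eventuallyEq (hGF t ht))
    (fun t ht => by have : 0 < t := ht; positivity) hGtop]
  simp only [G, Function.update_self]
  field_simp
  ring
end
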